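/- Reproducibility of truncated algebraic decay functions: For every integer d ≥ 1 and real α > d there exists a constant c₂ > 0 depending only on α and d such that for all Θ ≥ 0 and all R₁, R₂ ∈ ℤ^d, Σ_{R ∈ ℤ^d} F_Θ(R₁ − R) · F_Θ(R − R₂) ≤ c₂ (Θ + 1)^d F_Θ(R₁ − R₂), where F_Θ(R) = min{((Θ + 1)/(|R| + 1))^α, 1}. -/

import Mathlib

noncomputable section

/-- Euclidean norm of a lattice vector in `ℤ^d`. -/
def latNorm {d : ℕ} (r : Fin d → ℤ) : ℝ := Real.sqrt (∑ i, ((r i : ℝ)) ^ 2)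

/-- The truncated algebraic decay function `F_Θ(R) = min{((Θ+1)/(|R|+1))^α, 1}`. -/
def Ftrunc {d : ℕ} (α Θ : ℝ) (R : Fin d → ℤ) : ℝ := min (((Θ + 1) / (latNorm R + 1)) ^ α) 1

lemma latNorm_nonneg {d : ℕ} (R : Fin d → ℤ) : 0 ≤ latNorm R := Real.sqrt_nonneg _

lemma latNorm_eq_norm {d : ℕ} (R : Fin d → ℤ) :
    latNorm R = ‖WithLp.toLp 2 (fun i => (R i : ℝ))‖ := by
  simp [latNorm, EuclideanSpace.norm_eq]

lemma latNorm_add_le {d : ℕ} (a b : Fin d → ℤ) : latNorm (a + b) ≤ latNorm a + latNorm b := by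
  simp only [latNorm_eq_norm]
  refine Eq.trans_le (congrArg norm ?_) (norm_add_le _ _)
  ext i
  simp

lemma latNorm_neg {d : ℕ} (a : Fin d → ℤ) : latNorm (-a) = latNorm a := by
  simp [latNorm]

lemma latNorm_natCast_mul {d : ℕ} (n : ℕ) (a : Fin d → ℤ) :
    latNorm (fun i => a i * n) = n * latNorm a := by
  simp only [latNorm, Int.cast_mul, Int.cast_natCast, mul_pow, ← Finset.sum_mul]
  rw [mul_comm, Real.sqrt_mul (by positivity), Real.sqrt_sq (by positivity)]

lemma latNorm_fin_le {d n : ℕ} (r : Fin d → Fin n) :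
    latNorm (fun i => ((r i : ℕ) : ℤ)) ≤ n * d := by
  refine Real.sqrt_le_iff.2 ⟨by positivity, ?_⟩
  have hd : (d : ℝ) ≤ (d : ℝ) ^ 2 := mod_cast Nat.le_self_pow two_ne_zero d
  calc ∑ i, (((r i : ℕ) : ℤ) : ℝ) ^ 2 ≤ ∑ _i : Fin d, (n : ℝ) ^ 2 := by
        gcongr with i
        simp
    _ = n ^ 2 * d := by simp [mul_comm]
    _ ≤ n ^ 2 * d ^ 2 := by gcongr
    _ = (n * d) ^ 2 := by ring

/-- The lattice sum `∑ (|R| + 1)^(-α)` converges for `α > d`. -/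
lemma summable_latNorm_add_one_rpow {d : ℕ} {α : ℝ} (hα : (d : ℝ) < α) :
    Summable fun R : Fin d → ℤ => (latNorm R + 1) ^ (-α) := by
  have hα0 : 0 < α := d.cast_nonneg.trans_lt hα
  let b := (EuclideanSpace.basisFun (Fin d) ℝ).toBasis
  let L := Submodule.span ℤ (Set.range b)
  have hmem (R : Fin d → ℤ) : WithLp.toLp 2 (fun i => (R i : ℝ)) ∈ L := by
    rw [Module.Basis.mem_span_iff_repr_mem]
    intro i
    exact ⟨R i, by simp [b]⟩
  let φ : (Fin d → ℤ) → L := fun R => ⟨_, hmem R⟩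
  have hφ : Function.Injective φ := by
    intro R S h
    ext i
    have h' := congrArg (fun x : L => (x : EuclideanSpace ℝ (Fin d)) i) h
    simpa [φ] using h'
  have hrank : Module.finrank ℤ L = d := by
    rw [ZLattice.rank ℝ L]
    simp
  have hsum : Summable fun R => ‖φ R‖ ^ (-α) :=
    (ZLattice.summable_norm_rpow L (-α) (by rw [hrank]; linarith)).comp_injective hφ
  refine hsum.of_norm_bounded_eventually ?_
  refine (Set.finite_singleton (0 : Fin d → ℤ)).subset fun R hR => ?_
  by_contra hR0
  apply hR
  have hpos : 0 < ‖φ R‖ := by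
    refine norm_pos_iff.2 fun h => hR0 (hφ ?_)
    rw [h]
    ext i
    simp [φ]
  have hnorm : latNorm R = ‖φ R‖ := latNorm_eq_norm R
  rw [Set.mem_ofPred_eq, Real.norm_of_nonneg (by rw [hnorm]; positivity), hnorm]
  exact Real.rpow_le_rpow_of_nonpos hpos (by linarith) (by linarith)

lemma Ftrunc_nonneg {d : ℕ} {α Θ : ℝ} (hΘ : 0 ≤ Θ) (R : Fin d → ℤ) : 0 ≤ Ftrunc α Θ R := by
  have := latNorm_nonneg R
  exact le_min (by positivity) zero_le_one

lemma Ftrunc_le_two_rpow_mul {d : ℕ} {α Θ : ℝ} (hα : 0 ≤ α) (hΘ : 0 ≤ Θ) {a c : Fin d → ℤ}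
    (h : latNorm c + 1 ≤ 2 * (latNorm a + 1)) :
    Ftrunc α Θ a ≤ 2 ^ α * Ftrunc α Θ c := by
  have ha := latNorm_nonneg a
  have hc := latNorm_nonneg c
  unfold Ftrunc
  rw [mul_min_of_nonneg _ _ (by positivity), mul_one]
  refine min_le_min ?_ (Real.one_le_rpow one_le_two hα)
  rw [← Real.mul_rpow (by positivity) (by positivity)]
  refine Real.rpow_le_rpow (by positivity) ?_ hα
  rw [← mul_div_assoc, div_le_div_iff₀ (by positivity) (by positivity)]
  nlinarith

lemma Ftrunc_mul_le {d : ℕ} {α Θ : ℝ} (hα : 0 ≤ α) (hΘ : 0 ≤ Θ) (a b : Fin d → ℤ) :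
    Ftrunc α Θ a * Ftrunc α Θ b ≤
      2 ^ α * Ftrunc α Θ (a + b) * (Ftrunc α Θ a + Ftrunc α Θ b) := by
  have hadd := latNorm_add_le a b
  have ha := Ftrunc_nonneg (α := α) hΘ a
  have hb := Ftrunc_nonneg (α := α) hΘ b
  have hab : 0 ≤ 2 ^ α * Ftrunc α Θ (a + b) := mul_nonneg (by positivity) (Ftrunc_nonneg hΘ _)
  rcases le_total (latNorm a) (latNorm b) with h | h
  · have := Ftrunc_le_two_rpow_mul (a := b) (c := a + b) hα hΘ (by linarith)
    nlinarith [mul_nonneg hab hb]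
  · have := Ftrunc_le_two_rpow_mul (a := a) (c := a + b) hα hΘ (by linarith)
    nlinarith [mul_nonneg hab ha]

/-- Quotients and remainders modulo `n`, coordinate by coordinate. -/
def latDivMod (d n : ℕ) [NeZero n] : (Fin d → ℤ) ≃ (Fin d → ℤ) × (Fin d → Fin n) :=
  (Equiv.piCongrRight fun _ => Int.divModEquiv n).trans (Equiv.arrowProdEquivProdArrow _ _ _)

lemma latNorm_quotient_le {d n : ℕ} [NeZero n] (p : (Fin d → ℤ) × (Fin d → Fin n)) :
    n * latNorm p.1 ≤ latNorm ((latDivMod d n).symm p) + n * d := by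
  have h : (fun i => p.1 i * (n : ℤ)) =
      (latDivMod d n).symm p + -(fun i => ((p.2 i : ℕ) : ℤ)) := by
    ext i
    simp [latDivMod, Equiv.arrowProdEquivProdArrow]
  rw [← latNorm_natCast_mul, h]
  refine (latNorm_add_le _ _).trans ?_
  rw [latNorm_neg]
  gcongr
  exact latNorm_fin_le p.2

lemma Ftrunc_latDivMod_symm_le {d n : ℕ} [NeZero n] {α Θ : ℝ} (hα : 0 ≤ α) (hΘ : 0 ≤ Θ)
    (hn : Θ + 1 ≤ n) (p : (Fin d → ℤ) × (Fin d → Fin n)) :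
    Ftrunc α Θ ((latDivMod d n).symm p) ≤ (d + 2) ^ α * (latNorm p.1 + 1) ^ (-α) := by
  have hq := latNorm_quotient_le p
  have hq0 := latNorm_nonneg p.1
  have hR0 := latNorm_nonneg ((latDivMod d n).symm p)
  set R := (latDivMod d n).symm p
  have hn0 : (0 : ℝ) < n := by linarith
  rw [Real.rpow_neg (by positivity), ← div_eq_mul_inv,
    ← Real.div_rpow (by positivity) (by positivity)]
  rcases le_total (n : ℝ) (latNorm R + 1) with h | h
  · refine (min_le_left _ _).trans (Real.rpow_le_rpow (by positivity) ?_ hα)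
    rw [div_le_div_iff₀ (by positivity) (by positivity)]
    have h1 : (Θ + 1) * (latNorm p.1 + 1) ≤ n * (latNorm p.1 + 1) := by gcongr
    have h2 : (n : ℝ) * d ≤ (latNorm R + 1) * d := by gcongr
    linarith
  · refine (min_le_right _ _).trans (Real.one_le_rpow ?_ hα)
    rw [one_le_div (by positivity)]
    have h1 : n * latNorm p.1 ≤ n * (d + 1) := by linarith
    linarith [le_of_mul_le_mul_left h1 hn0]

lemma summable_Ftrunc_and_tsum_le {d : ℕ} {α : ℝ} (hα : (d : ℝ) < α) {Θ : ℝ} (hΘ : 0 ≤ Θ) :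
    Summable (Ftrunc (d := d) α Θ) ∧ ∑' R : Fin d → ℤ, Ftrunc α Θ R ≤
      (d + 2) ^ α * (∑' R : Fin d → ℤ, (latNorm R + 1) ^ (-α)) * 2 ^ d * (Θ + 1) ^ d := by
  have hα0 : 0 ≤ α := d.cast_nonneg.trans hα.le
  obtain ⟨n, hn, hn2⟩ : ∃ n : ℕ, Θ + 1 ≤ n ∧ (n : ℝ) ≤ 2 * (Θ + 1) :=
    ⟨⌈Θ + 1⌉₊, Nat.le_ceil _, by linarith [Nat.ceil_lt_add_one (a := Θ + 1) (by linarith)]⟩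
  have : NeZero n := ⟨by rintro rfl; norm_num at hn; linarith⟩
  set g : (Fin d → ℤ) → ℝ := fun q => (d + 2) ^ α * (latNorm q + 1) ^ (-α)
  have hg : Summable g := (summable_latNorm_add_one_rpow hα).mul_left _
  have hg0 (q) : 0 ≤ g q := by
    have := latNorm_nonneg q
    positivity
  have hbound := Ftrunc_latDivMod_symm_le (d := d) (n := n) hα0 hΘ hn
  have hprod : Summable fun p : (Fin d → ℤ) × (Fin d → Fin n) => g p.1 := by
    simpa using hg.mul_of_nonneg (g := fun _ : Fin d → Fin n => (1 : ℝ)) .of_finite hg0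
      (fun _ => zero_le_one)
  have hF : Summable fun p => Ftrunc α Θ ((latDivMod d n).symm p) :=
    hprod.of_nonneg_of_le (fun _ => Ftrunc_nonneg hΘ _) hbound
  refine ⟨(latDivMod d n).symm.summable_iff.1 hF, ?_⟩
  rw [← (latDivMod d n).symm.tsum_eq]
  refine (hF.tsum_le_tsum hbound hprod).trans ?_
  have heq : ∑' p : (Fin d → ℤ) × (Fin d → Fin n), g p.1 = (n : ℝ) ^ d * ∑' q, g q := by
    rw [hprod.tsum_prod, ← tsum_mul_left]
    simp
  change ∑' p : (Fin d → ℤ) × (Fin d → Fin n), g p.1 ≤ _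
  rw [heq, ← tsum_mul_left (a := ((d : ℝ) + 2) ^ α), mul_assoc, ← mul_pow, mul_comm]
  exact mul_le_mul_of_nonneg_left (pow_le_pow_left₀ n.cast_nonneg hn2 d) (tsum_nonneg hg0)

/-- **Reproducibility of truncated algebraic decay functions** (Proposition S2):
for every `d ≥ 1` and `α > d` there is a constant `c₂` depending only on `α` and `d`
such that for all `Θ ≥ 0` and all `R₁, R₂ ∈ ℤ^d`,
`∑_R F_Θ(R₁-R) F_Θ(R-R₂) ≤ c₂ (Θ+1)^d F_Θ(R₁-R₂)`. -/
theorem reproducibility_truncated_algebraic (d : ℕ) (hd : 1 ≤ d) (α : ℝ) (hα : (d : ℝ) < α) :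
    ∃ c₂ : ℝ, 0 < c₂ ∧
      ∀ (Θ : ℝ), 0 ≤ Θ → ∀ R₁ R₂ : Fin d → ℤ,
        (∑' R : Fin d → ℤ, Ftrunc α Θ (R₁ - R) * Ftrunc α Θ (R - R₂)) ≤
          c₂ * (Θ + 1) ^ d * Ftrunc α Θ (R₁ - R₂) := by
  have hα0 : 0 ≤ α := d.cast_nonneg.trans hα.le
  set S : ℝ := ∑' R : Fin d → ℤ, (latNorm R + 1) ^ (-α)
  have hS : 0 ≤ S := tsum_nonneg fun R => by
    have := latNorm_nonneg R
    positivity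
  refine ⟨2 ^ α * (2 * ((d + 2) ^ α * S * 2 ^ d)) + 1, by positivity, fun Θ hΘ R₁ R₂ => ?_⟩
  obtain ⟨hsum, hle⟩ := summable_Ftrunc_and_tsum_le hα hΘ
  have hF0 := Ftrunc_nonneg (α := α) hΘ (R₁ - R₂)
  have hs₁ : Summable fun R => Ftrunc α Θ (R₁ - R) := (Equiv.subLeft R₁).summable_iff.2 hsum
  have hs₂ : Summable fun R => Ftrunc α Θ (R - R₂) := (Equiv.subRight R₂).summable_iff.2 hsum
  have ht₁ : ∑' R, Ftrunc α Θ (R₁ - R) = ∑' R : Fin d → ℤ, Ftrunc α Θ R :=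
    (Equiv.subLeft R₁).tsum_eq (Ftrunc α Θ)
  have ht₂ : ∑' R, Ftrunc α Θ (R - R₂) = ∑' R : Fin d → ℤ, Ftrunc α Θ R :=
    (Equiv.subRight R₂).tsum_eq (Ftrunc α Θ)
  have hbound (R : Fin d → ℤ) : Ftrunc α Θ (R₁ - R) * Ftrunc α Θ (R - R₂) ≤
      2 ^ α * Ftrunc α Θ (R₁ - R₂) * (Ftrunc α Θ (R₁ - R) + Ftrunc α Θ (R - R₂)) := by
    simpa using Ftrunc_mul_le hα0 hΘ (R₁ - R) (R - R₂)
  have hmaj := (hs₁.add hs₂).mul_left (2 ^ α * Ftrunc α Θ (R₁ - R₂))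
  have hprod := hmaj.of_nonneg_of_le
    (fun R => mul_nonneg (Ftrunc_nonneg hΘ (R₁ - R)) (Ftrunc_nonneg hΘ (R - R₂))) hbound
  calc _ ≤ _ := hprod.tsum_le_tsum hbound hmaj
    _ = 2 ^ α * Ftrunc α Θ (R₁ - R₂) * (2 * ∑' R : Fin d → ℤ, Ftrunc α Θ R) := by
        rw [tsum_mul_left, hs₁.tsum_add hs₂, ht₁, ht₂, two_mul]
    _ ≤ 2 ^ α * Ftrunc α Θ (R₁ - R₂) * (2 * ((d + 2) ^ α * S * 2 ^ d * (Θ + 1) ^ d)) := by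
        gcongr
    _ = 2 ^ α * (2 * ((d + 2) ^ α * S * 2 ^ d)) * (Θ + 1) ^ d * Ftrunc α Θ (R₁ - R₂) := by
        ring
    _ ≤ _ := by
        gcongr
        exact le_add_of_nonneg_right zero_le_one

end
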